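/- Let B > 0, γ > 0, T_b ∈ [0,γ], ψ_b : (0,1] → ℝ measurable with 0 ≤ ψ_b ≤ γ⁴. Suppose T ∈ C²([0,B]) and ψ : [0,B]×[-1,1] → ℝ (with x ↦ ψ(x,μ) C¹ for each μ ≠ 0, 0 ≤ T ≤ γ, 0 ≤ ψ ≤ γ⁴) satisfy T'' + ∫_{-1}^{1}(ψ − T⁴)dμ = 0 and μ∂_xψ + ψ − T⁴ = 0 on [0,B] (for μ ≠ 0), with T(0) = T_b, T'(B) = 0, ψ(0,μ) = ψ_b(μ) and ψ(B,μ) = ψ(B,−μ) for μ ∈ (0,1]. Then for every α ∈ [0,1): ∫₀^B e^{2αx} 4 T(x)³ T'(x)² dx + (1−α) ∫₀^B ∫_{-1}^{1} e^{2αx} (ψ(x,μ) − T(x)⁴)² dμ dx + (1/2) ∫_{-1}^{0} |μ| (ψ(0,μ) − T_b⁴)² dμ ≤ (1/2) ∫₀¹ μ (ψ_b(μ) − T_b⁴)² dμ. -/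

import Mathlib

open MeasureTheory Set

/-- A continuous function of a point and of a bounded measurable function is integrable against
a finite measure carried by a compact set. -/
theorem integrable_continuous_comp_bounded {α : Type*} [TopologicalSpace α] [MeasurableSpace α]
    [BorelSpace α] [SecondCountableTopology α] {ν : Measure α} [IsFiniteMeasure ν] {K : Set α}
    (hK : IsCompact K) (hν : ∀ᵐ p ∂ν, p ∈ K) {w : α → ℝ} (hw : Measurable w) {M : ℝ}
    (hM : ∀ p, w p ∈ Icc 0 M) {P : α × ℝ → ℝ} (hP : Continuous P) :
    Integrable (fun p => P (p, w p)) ν := by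
  obtain ⟨C, hC⟩ := (hK.prod (isCompact_Icc (a := (0 : ℝ)) (b := M))).exists_bound_of_continuousOn
    hP.continuousOn
  refine Integrable.of_bound (hP.measurable.comp (measurable_id.prodMk hw)).aestronglyMeasurable
    C ?_
  filter_upwards [hν] with p hp
  exact hC _ ⟨hp, hM p⟩

theorem intervalIntegrable_continuous_comp_bounded {w : ℝ → ℝ} (hw : Measurable w) {M : ℝ}
    (hM : ∀ p, w p ∈ Icc 0 M) {P : ℝ × ℝ → ℝ} (hP : Continuous P) {a b : ℝ} (hab : a ≤ b) :
    IntervalIntegrable (fun p => P (p, w p)) volume a b := by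
  rw [intervalIntegrable_iff_integrableOn_Ioc_of_le hab]
  refine integrable_continuous_comp_bounded (isCompact_Icc (a := a) (b := b)) ?_ hw hM hP
  exact ae_restrict_of_forall_mem measurableSet_Ioc fun _ h => Ioc_subset_Icc_self h

theorem integrable_prod_continuous_comp_bounded {v : ℝ → ℝ → ℝ}
    (hv : Measurable (Function.uncurry v)) {M : ℝ} (hM : ∀ x μ, v x μ ∈ Icc 0 M)
    {P : (ℝ × ℝ) × ℝ → ℝ} (hP : Continuous P) (a b c d : ℝ) :
    Integrable (Function.uncurry fun x μ => P ((x, μ), v x μ))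
      ((volume.restrict (Ioc a b)).prod (volume.restrict (Ioc c d))) := by
  refine integrable_continuous_comp_bounded (P := P) (w := Function.uncurry v)
    ((isCompact_Icc (a := a) (b := b)).prod (isCompact_Icc (a := c) (b := d)))
    ?_ hv (fun p => hM p.1 p.2) hP
  rw [Measure.prod_restrict]
  exact ae_restrict_of_forall_mem (measurableSet_Ioc.prod measurableSet_Ioc)
    fun _ h => ⟨Ioc_subset_Icc_self h.1, Ioc_subset_Icc_self h.2⟩

theorem intervalIntegral_swap_continuous_comp_bounded {v : ℝ → ℝ → ℝ}
    (hv : Measurable (Function.uncurry v)) {M : ℝ} (hM : ∀ x μ, v x μ ∈ Icc 0 M)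
    {P : (ℝ × ℝ) × ℝ → ℝ} (hP : Continuous P) {a b c d : ℝ} (hab : a ≤ b) (hcd : c ≤ d) :
    (∫ μ in c..d, ∫ x in a..b, P ((x, μ), v x μ)) =
      ∫ x in a..b, ∫ μ in c..d, P ((x, μ), v x μ) := by
  simp only [intervalIntegral.integral_of_le hab, intervalIntegral.integral_of_le hcd]
  exact (integral_integral_swap
    (integrable_prod_continuous_comp_bounded hv hM hP a b c d)).symm

theorem intervalIntegrable_integral_continuous_comp_bounded {v : ℝ → ℝ → ℝ}
    (hv : Measurable (Function.uncurry v)) {M : ℝ} (hM : ∀ x μ, v x μ ∈ Icc 0 M)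
    {P : (ℝ × ℝ) × ℝ → ℝ} (hP : Continuous P) {a b c d : ℝ} (hab : a ≤ b) (hcd : c ≤ d) :
    IntervalIntegrable (fun x => ∫ μ in c..d, P ((x, μ), v x μ)) volume a b := by
  rw [intervalIntegrable_iff_integrableOn_Ioc_of_le hab]
  simp only [intervalIntegral.integral_of_le hcd]
  exact (integrable_prod_continuous_comp_bounded hv hM hP a b c d).integral_prod_left

theorem integral_eq_sub_of_hasDerivWithinAt_Icc {a b : ℝ} (hab : a ≤ b) {f f' : ℝ → ℝ}
    (hf : ∀ x ∈ Icc a b, HasDerivWithinAt f (f' x) (Icc a b) x) (hf' : ContinuousOn f' (Icc a b)) :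
    ∫ x in a..b, f' x = f b - f a := by
  refine intervalIntegral.integral_eq_sub_of_hasDerivAt_of_le hab
    (fun x hx => (hf x hx).continuousWithinAt)
    (fun x hx => (hf x (Ioo_subset_Icc_self hx)).hasDerivAt (Icc_mem_nhds hx.1 hx.2)) ?_
  exact ContinuousOn.intervalIntegrable_of_Icc hab hf'

theorem intervalIntegral_congr_off_zero {f g : ℝ → ℝ} {a b : ℝ} (hab : a ≤ b)
    (h : ∀ μ ∈ Icc a b, μ ≠ 0 → f μ = g μ) : ∫ μ in a..b, f μ = ∫ μ in a..b, g μ := by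
  refine intervalIntegral.integral_congr_ae ?_
  filter_upwards [Measure.ae_ne volume (0 : ℝ)] with μ hμ hmem
  rw [uIoc_of_le hab] at hmem
  exact h μ (Ioc_subset_Icc_self hmem) hμ

theorem intervalIntegral_eq_zero_of_odd {f : ℝ → ℝ} {a : ℝ} (ha : 0 ≤ a)
    (h : ∀ μ ∈ Ioc 0 a, f (-μ) = -f μ) : ∫ μ in -a..a, f μ = 0 := by
  have h1 : ∫ μ in -a..a, f (-μ) = ∫ μ in -a..a, f μ := by
    rw [intervalIntegral.integral_comp_neg, neg_neg]
  have h2 : ∫ μ in -a..a, f (-μ) = ∫ μ in -a..a, -f μ := by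
    refine intervalIntegral_congr_off_zero (by linarith) fun μ hμ hne => ?_
    rcases lt_or_gt_of_ne hne with hlt | hgt
    · have := h (-μ) ⟨by linarith, by linarith [hμ.1]⟩
      rw [neg_neg] at this
      linarith
    · exact h μ ⟨hgt, hμ.2⟩
  rw [intervalIntegral.integral_neg] at h2
  linarith

/-- The net flux `∫ μ ψ dμ` of a solution of the Milne problem equals `T'`. -/
theorem milne_flux {B M : ℝ} {v : ℝ → ℝ → ℝ} (hv : Measurable (Function.uncurry v))
    (hM : ∀ x μ, v x μ ∈ Icc 0 M) {τ σ σ' : ℝ → ℝ} (hτ : Continuous τ)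
    (hσ' : ∀ x ∈ Icc 0 B, HasDerivWithinAt σ (σ' x) (Icc 0 B) x)
    (hσ'c : ContinuousOn σ' (Icc 0 B))
    (hode : ∀ x ∈ Icc 0 B, σ' x + (∫ μ in (-1 : ℝ)..1, (v x μ - τ x ^ 4)) = 0)
    (htr : ∀ μ ∈ Icc (-1 : ℝ) 1, μ ≠ 0 → ∀ x ∈ Icc 0 B,
      HasDerivWithinAt (fun y => v y μ) ((τ x ^ 4 - v x μ) / μ) (Icc 0 B) x)
    (hσB : σ B = 0) (hvB : ∀ μ ∈ Ioc (0 : ℝ) 1, v B (-μ) = v B μ) {x : ℝ} (hx : x ∈ Icc 0 B) :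
    ∫ μ in (-1 : ℝ)..1, μ * v x μ = σ x := by
  have hsub : Icc x B ⊆ Icc 0 B := Icc_subset_Icc_left hx.1
  have hvm : ∀ y, Measurable (v y) := fun y => hv.comp measurable_prodMk_left
  have hii : ∀ y, IntervalIntegrable (fun μ => μ * v y μ) volume (-1) 1 := fun y =>
    intervalIntegrable_continuous_comp_bounded (P := fun p => p.1 * p.2) (hvm y) (hM y)
      (by fun_prop) (by norm_num)
  have hB0 : ∫ μ in (-1 : ℝ)..1, μ * v B μ = 0 :=
    intervalIntegral_eq_zero_of_odd zero_le_one fun μ hμ => by rw [hvB μ hμ]; ring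
  have hchar : ∫ μ in (-1 : ℝ)..1, ∫ y in x..B, (v y μ - τ y ^ 4) =
      ∫ μ in (-1 : ℝ)..1, (μ * v x μ - μ * v B μ) := by
    refine intervalIntegral_congr_off_zero (by norm_num) fun μ hμ hne => ?_
    have hd : ∀ y ∈ Icc x B, HasDerivWithinAt (fun y => -(μ * v y μ)) (v y μ - τ y ^ 4)
        (Icc x B) y := fun y hy => by
      refine ((((htr μ hμ hne y (hsub hy)).mono hsub).const_mul μ).neg).congr_deriv ?_
      field_simp
      ring
    rw [integral_eq_sub_of_hasDerivWithinAt_Icc hx.2 hd]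
    · ring
    · refine ContinuousOn.sub (fun y hy => ?_) (by fun_prop)
      exact ((htr μ hμ hne y (hsub hy)).mono hsub).continuousWithinAt
  rw [intervalIntegral_swap_continuous_comp_bounded
      (P := fun q => q.2 - τ q.1.1 ^ 4) hv hM (by fun_prop) hx.2 (by norm_num),
    intervalIntegral.integral_sub (hii x) (hii B), hB0, sub_zero] at hchar
  rw [← hchar]
  have : ∫ y in x..B, ∫ μ in (-1 : ℝ)..1, (v y μ - τ y ^ 4) = ∫ y in x..B, -σ' y := by
    refine intervalIntegral.integral_congr fun y hy => ?_
    rw [uIcc_of_le hx.2] at hy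
    linarith [hode y (hsub hy)]
  rw [this, intervalIntegral.integral_neg, integral_eq_sub_of_hasDerivWithinAt_Icc hx.2
    (fun y hy => (hσ' y (hsub hy)).mono hsub) (hσ'c.mono hsub), hσB]
  ring

/-- The weighted energy identity for the Milne problem. -/
theorem milne_energy_identity {B M : ℝ} (hB : 0 ≤ B) {v : ℝ → ℝ → ℝ}
    (hv : Measurable (Function.uncurry v))
    (hM : ∀ x μ, v x μ ∈ Icc 0 M) {τ σ : ℝ → ℝ} (hτ : Continuous τ) (hσ : Continuous σ)
    (hτ' : ∀ x ∈ Icc 0 B, HasDerivWithinAt τ (σ x) (Icc 0 B) x)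
    (htr : ∀ μ ∈ Icc (-1 : ℝ) 1, μ ≠ 0 → ∀ x ∈ Icc 0 B,
      HasDerivWithinAt (fun y => v y μ) ((τ x ^ 4 - v x μ) / μ) (Icc 0 B) x)
    (hvB : ∀ μ ∈ Ioc (0 : ℝ) 1, v B (-μ) = v B μ) (α : ℝ) :
    (∫ x in 0..B, ∫ μ in (-1 : ℝ)..1, Real.exp (2 * α * x) *
      ((1 - α * μ) * (v x μ - τ x ^ 4) ^ 2 + 4 * τ x ^ 3 * σ x * (μ * (v x μ - τ x ^ 4)))) =
      (1 / 2) * ∫ μ in (-1 : ℝ)..1, μ * (v 0 μ - τ 0 ^ 4) ^ 2 := by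
  have hvm : ∀ y, Measurable (v y) := fun y => hv.comp measurable_prodMk_left
  have hii : ∀ y, IntervalIntegrable (fun μ => μ * (v y μ - τ y ^ 4) ^ 2) volume (-1) 1 := fun y =>
    intervalIntegrable_continuous_comp_bounded (P := fun p => p.1 * (p.2 - τ y ^ 4) ^ 2)
      (hvm y) (hM y) (by fun_prop) (by norm_num)
  have hB0 : ∫ μ in (-1 : ℝ)..1, μ * (v B μ - τ B ^ 4) ^ 2 = 0 :=
    intervalIntegral_eq_zero_of_odd zero_le_one fun μ hμ => by rw [hvB μ hμ]; ring
  rw [← intervalIntegral_swap_continuous_comp_bounded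
      (P := fun q => Real.exp (2 * α * q.1.1) * ((1 - α * q.1.2) * (q.2 - τ q.1.1 ^ 4) ^ 2 +
        4 * τ q.1.1 ^ 3 * σ q.1.1 * (q.1.2 * (q.2 - τ q.1.1 ^ 4))))
      hv hM (by fun_prop) hB (by norm_num)]
  have hchar : (∫ μ in (-1 : ℝ)..1, ∫ x in 0..B, Real.exp (2 * α * x) *
      ((1 - α * μ) * (v x μ - τ x ^ 4) ^ 2 + 4 * τ x ^ 3 * σ x * (μ * (v x μ - τ x ^ 4)))) =
      ∫ μ in (-1 : ℝ)..1, ((1 / 2) * (μ * (v 0 μ - τ 0 ^ 4) ^ 2) -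
        (1 / 2) * Real.exp (2 * α * B) * (μ * (v B μ - τ B ^ 4) ^ 2)) := by
    refine intervalIntegral_congr_off_zero (by norm_num) fun μ hμ hne => ?_
    have hd : ∀ x ∈ Icc 0 B, HasDerivWithinAt
        (fun x => -(Real.exp (2 * α * x) * ((μ / 2) * (v x μ - τ x ^ 4) ^ 2)))
        (Real.exp (2 * α * x) * ((1 - α * μ) * (v x μ - τ x ^ 4) ^ 2 +
          4 * τ x ^ 3 * σ x * (μ * (v x μ - τ x ^ 4)))) (Icc 0 B) x := fun x hx => by
      have h1 : HasDerivWithinAt (fun x => Real.exp (2 * α * x))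
          (Real.exp (2 * α * x) * (2 * α * 1)) (Icc 0 B) x :=
        (((hasDerivAt_id x).const_mul (2 * α)).exp).hasDerivWithinAt
      have h2 := (((htr μ hμ hne x hx).sub ((hτ' x hx).pow 4)).pow 2).const_mul (μ / 2)
      refine (h1.mul h2).neg.congr_deriv ?_
      simp only [Pi.sub_apply, Pi.pow_apply]
      field_simp
      ring
    rw [integral_eq_sub_of_hasDerivWithinAt_Icc hB hd]
    · simp only [mul_zero, Real.exp_zero]
      ring
    · have hc : ContinuousOn (fun y => v y μ) (Icc 0 B) := fun y hy =>
        (htr μ hμ hne y hy).continuousWithinAt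
      fun_prop
  rw [hchar, intervalIntegral.integral_sub ((hii 0).const_mul _) ((hii B).const_mul _),
    intervalIntegral.integral_const_mul, intervalIntegral.integral_const_mul, hB0]
  ring

/-- The weighted energy estimate for the Milne problem, for jointly measurable intensities. -/
theorem milne_energy_le {B M : ℝ} (hB : 0 ≤ B) {v : ℝ → ℝ → ℝ}
    (hv : Measurable (Function.uncurry v))
    (hM : ∀ x μ, v x μ ∈ Icc 0 M) {τ σ σ' : ℝ → ℝ} (hτ : Continuous τ) (hσ : Continuous σ)
    (hτ' : ∀ x ∈ Icc 0 B, HasDerivWithinAt τ (σ x) (Icc 0 B) x)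
    (hσ' : ∀ x ∈ Icc 0 B, HasDerivWithinAt σ (σ' x) (Icc 0 B) x)
    (hσ'c : ContinuousOn σ' (Icc 0 B))
    (hode : ∀ x ∈ Icc 0 B, σ' x + (∫ μ in (-1 : ℝ)..1, (v x μ - τ x ^ 4)) = 0)
    (htr : ∀ μ ∈ Icc (-1 : ℝ) 1, μ ≠ 0 → ∀ x ∈ Icc 0 B,
      HasDerivWithinAt (fun y => v y μ) ((τ x ^ 4 - v x μ) / μ) (Icc 0 B) x)
    (hσB : σ B = 0) (hvB : ∀ μ ∈ Ioc (0 : ℝ) 1, v B (-μ) = v B μ) {α : ℝ} (hα : 0 ≤ α) :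
    (∫ x in 0..B, Real.exp (2 * α * x) * (4 * τ x ^ 3 * σ x ^ 2))
      + (1 - α) * (∫ x in 0..B, ∫ μ in (-1 : ℝ)..1,
          Real.exp (2 * α * x) * (v x μ - τ x ^ 4) ^ 2)
      + (1 / 2) * (∫ μ in (-1 : ℝ)..0, |μ| * (v 0 μ - τ 0 ^ 4) ^ 2)
      ≤ (1 / 2) * ∫ μ in (0 : ℝ)..1, μ * (v 0 μ - τ 0 ^ 4) ^ 2 := by
  have hvm : ∀ y, Measurable (v y) := fun y => hv.comp measurable_prodMk_left
  have hid := milne_energy_identity hB hv hM hτ hσ hτ' htr hvB α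
  have hii : ∀ {a b : ℝ}, a ≤ b →
      IntervalIntegrable (fun μ => μ * (v 0 μ - τ 0 ^ 4) ^ 2) volume a b := fun hab =>
    intervalIntegrable_continuous_comp_bounded (P := fun p => p.1 * (p.2 - τ 0 ^ 4) ^ 2)
      (hvm 0) (hM 0) (by fun_prop) hab
  have habs : ∫ μ in (-1 : ℝ)..0, |μ| * (v 0 μ - τ 0 ^ 4) ^ 2 =
      -∫ μ in (-1 : ℝ)..0, μ * (v 0 μ - τ 0 ^ 4) ^ 2 := by
    rw [← intervalIntegral.integral_neg]
    refine intervalIntegral_congr_off_zero (by norm_num) fun μ hμ _ => ?_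
    rw [abs_of_nonpos hμ.2]
    ring
  have hsplit := intervalIntegral.integral_add_adjacent_intervals
    (hii (a := -1) (b := 0) (by norm_num)) (hii (a := 0) (b := 1) (by norm_num))
  have hint1 : IntervalIntegrable (fun x => Real.exp (2 * α * x) * (4 * τ x ^ 3 * σ x ^ 2))
      volume 0 B := Continuous.intervalIntegrable (by fun_prop) _ _
  have hint2 : IntervalIntegrable (fun x => (1 - α) * ∫ μ in (-1 : ℝ)..1,
      Real.exp (2 * α * x) * (v x μ - τ x ^ 4) ^ 2) volume 0 B :=
    (intervalIntegrable_integral_continuous_comp_bounded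
      (P := fun q => Real.exp (2 * α * q.1.1) * (q.2 - τ q.1.1 ^ 4) ^ 2)
      hv hM (by fun_prop) hB (by norm_num)).const_mul _
  have hmono : (∫ x in 0..B, (Real.exp (2 * α * x) * (4 * τ x ^ 3 * σ x ^ 2) +
      (1 - α) * ∫ μ in (-1 : ℝ)..1, Real.exp (2 * α * x) * (v x μ - τ x ^ 4) ^ 2)) ≤
      ∫ x in 0..B, ∫ μ in (-1 : ℝ)..1, Real.exp (2 * α * x) *
        ((1 - α * μ) * (v x μ - τ x ^ 4) ^ 2 +
          4 * τ x ^ 3 * σ x * (μ * (v x μ - τ x ^ 4))) := by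
    refine intervalIntegral.integral_mono_on hB (hint1.add hint2)
      (intervalIntegrable_integral_continuous_comp_bounded
        (P := fun q => Real.exp (2 * α * q.1.1) * ((1 - α * q.1.2) * (q.2 - τ q.1.1 ^ 4) ^ 2 +
          4 * τ q.1.1 ^ 3 * σ q.1.1 * (q.1.2 * (q.2 - τ q.1.1 ^ 4))))
        hv hM (by fun_prop) hB (by norm_num)) fun x hx => ?_
    have hi : ∀ {P : ℝ × ℝ → ℝ}, Continuous P →
        IntervalIntegrable (fun μ => P (μ, v x μ)) volume (-1) 1 := fun hP =>
      intervalIntegrable_continuous_comp_bounded (hvm x) (hM x) hP (by norm_num)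
    have hflux : ∫ μ in (-1 : ℝ)..1, μ * (v x μ - τ x ^ 4) = σ x := by
      rw [← milne_flux hv hM hτ hσ' hσ'c hode htr hσB hvB hx]
      simp only [mul_sub]
      rw [intervalIntegral.integral_sub (hi (P := fun p => p.1 * p.2) (by fun_prop))
        (hi (P := fun p => p.1 * τ x ^ 4) (by fun_prop)), intervalIntegral.integral_mul_const,
        integral_id]
      norm_num
    have heq : Real.exp (2 * α * x) * (4 * τ x ^ 3 * σ x ^ 2) +
        (1 - α) * (∫ μ in (-1 : ℝ)..1, Real.exp (2 * α * x) * (v x μ - τ x ^ 4) ^ 2) =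
        ∫ μ in (-1 : ℝ)..1, (Real.exp (2 * α * x) * (4 * τ x ^ 3 * σ x) *
          (μ * (v x μ - τ x ^ 4)) +
          (1 - α) * (Real.exp (2 * α * x) * (v x μ - τ x ^ 4) ^ 2)) := by
      rw [intervalIntegral.integral_add
        (hi (P := fun p => Real.exp (2 * α * x) * (4 * τ x ^ 3 * σ x) * (p.1 * (p.2 - τ x ^ 4)))
          (by fun_prop))
        (hi (P := fun p => (1 - α) * (Real.exp (2 * α * x) * (p.2 - τ x ^ 4) ^ 2))
          (by fun_prop))]
      simp only [intervalIntegral.integral_const_mul, hflux]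
      ring
    rw [heq]
    refine intervalIntegral.integral_mono_on (by norm_num)
      (hi (P := fun p => Real.exp (2 * α * x) * (4 * τ x ^ 3 * σ x) * (p.1 * (p.2 - τ x ^ 4)) +
        (1 - α) * (Real.exp (2 * α * x) * (p.2 - τ x ^ 4) ^ 2)) (by fun_prop))
      (hi (P := fun p => Real.exp (2 * α * x) * ((1 - α * p.1) * (p.2 - τ x ^ 4) ^ 2 +
          4 * τ x ^ 3 * σ x * (p.1 * (p.2 - τ x ^ 4)))) (by fun_prop)) fun μ hμ => ?_
    have : 0 ≤ α * (1 - μ) * (Real.exp (2 * α * x) * (v x μ - τ x ^ 4) ^ 2) :=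
      mul_nonneg (mul_nonneg hα (by linarith [hμ.2])) (by positivity)
    linarith
  rw [intervalIntegral.integral_add hint1 hint2, intervalIntegral.integral_const_mul] at hmono
  linarith

/-- Explicit solution of the transport equation `μ ∂_x f + f = g` along a characteristic. -/
theorem transport_eq {B μ : ℝ} (hμ : μ ≠ 0) {f g : ℝ → ℝ} (hg : Continuous g)
    (hf : ∀ x ∈ Icc 0 B, HasDerivWithinAt f ((g x - f x) / μ) (Icc 0 B) x) {x : ℝ}
    (hx : x ∈ Icc 0 B) :
    Real.exp (x / μ) * f x = f 0 + ∫ y in 0..x, Real.exp (y / μ) * (g y / μ) := by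
  have hsub : Icc 0 x ⊆ Icc 0 B := Icc_subset_Icc_right hx.2
  have hd : ∀ y ∈ Icc 0 x, HasDerivWithinAt (fun y => Real.exp (y / μ) * f y)
      (Real.exp (y / μ) * (g y / μ)) (Icc 0 x) y := fun y hy => by
    have h1 : HasDerivWithinAt (fun y => Real.exp (y / μ)) (Real.exp (y / μ) * (1 / μ))
        (Icc 0 x) y := (((hasDerivAt_id y).div_const μ).exp).hasDerivWithinAt
    refine (h1.mul ((hf y (hsub hy)).mono hsub)).congr_deriv ?_
    field_simp
    ring
  rw [integral_eq_sub_of_hasDerivWithinAt_Icc hx.1 hd (by fun_prop)]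
  simp

/-- A solution of the transport equation with measurable incoming data and specular reflection
agrees, away from `μ = 0`, with a jointly measurable function. -/
theorem exists_measurable_intensity {B M : ℝ} (hB : 0 ≤ B) (hM0 : 0 ≤ M) {ψ : ℝ → ℝ → ℝ}
    {ψb g : ℝ → ℝ} (hψb : Measurable ψb) (hg : Continuous g)
    (htr : ∀ μ ∈ Icc (-1 : ℝ) 1, μ ≠ 0 → ∀ x ∈ Icc 0 B,
      HasDerivWithinAt (fun y => ψ y μ) ((g x - ψ x μ) / μ) (Icc 0 B) x)
    (hM : ∀ x ∈ Icc 0 B, ∀ μ ∈ Icc (-1 : ℝ) 1, ψ x μ ∈ Icc 0 M)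
    (hψ0 : ∀ μ ∈ Ioc (0 : ℝ) 1, ψ 0 μ = ψb μ)
    (hψB : ∀ μ ∈ Ioc (0 : ℝ) 1, ψ B μ = ψ B (-μ)) :
    ∃ v : ℝ → ℝ → ℝ, Measurable (Function.uncurry v) ∧ (∀ x μ, v x μ ∈ Icc 0 M) ∧
      ∀ x ∈ Icc 0 B, ∀ μ ∈ Icc (-1 : ℝ) 1, μ ≠ 0 → v x μ = ψ x μ := by
  classical
  let c : ℝ → ℝ := fun x => projIcc 0 B hB x
  have hcm : ∀ x, c x ∈ Icc 0 B := fun x => (projIcc 0 B hB x).2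
  have hcc : Continuous c := continuous_subtype_val.comp continuous_projIcc
  have hce : ∀ x ∈ Icc 0 B, c x = x := fun x hx => by simp [c, projIcc_of_mem hB hx]
  let S : Set ℝ := Icc (-1 : ℝ) 1 \ {0}
  have hS : MeasurableSet S := measurableSet_Icc.diff (measurableSet_singleton 0)
  let G : ℝ → ℝ → ℝ := fun x μ => ∫ y in 0..x, Real.exp (y / μ) * (g y / μ)
  have hG : ∀ x, 0 ≤ x → Measurable (G x) := fun x hx => by
    simp only [G, intervalIntegral.integral_of_le hx]
    refine (StronglyMeasurable.integral_prod_right (f := fun μ y => Real.exp (y / μ) * (g y / μ))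
      (Measurable.stronglyMeasurable ?_)).measurable
    have := hg.measurable
    simp only [Function.uncurry_def]
    fun_prop
  let I : ℝ → ℝ := fun μ => if 0 < μ then ψb μ else
    Real.exp (B / μ) * (Real.exp (B / μ) * (ψb (-μ) + G B (-μ))) - G B μ
  have hI : Measurable I := by
    have := hG B hB
    refine Measurable.ite measurableSet_Ioi hψb ?_
    fun_prop
  have hI0 : ∀ μ ∈ S, ψ 0 μ = I μ := fun μ hμ => by
    obtain ⟨hμ, hne : μ ≠ 0⟩ := hμ
    by_cases hpos : 0 < μ
    · simp only [I, if_pos hpos, hψ0 μ ⟨hpos, hμ.2⟩]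
    · have hneg : 0 < -μ := by
        rcases lt_or_gt_of_ne hne with h | h
        · linarith
        · exact absurd h hpos
      have hm : -μ ∈ Ioc (0 : ℝ) 1 := ⟨hneg, by linarith [hμ.1]⟩
      have e1 := transport_eq hne hg (htr μ hμ hne) (right_mem_Icc.2 hB)
      have e2 := transport_eq hneg.ne' hg (htr (-μ) ⟨by linarith [hm.1], hm.2⟩ hneg.ne')
        (right_mem_Icc.2 hB)
      have e3 := hψB _ hm
      rw [neg_neg] at e3
      rw [hψ0 _ hm, e3] at e2
      simp only [I, if_neg hpos, G]
      rw [← e2, div_neg, Real.exp_neg, mul_inv_cancel_left₀ (Real.exp_ne_zero _), e1]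
      ring
  refine ⟨fun x => S.indicator (ψ (c x)), ?_, fun x μ => ?_, fun x hx μ hμ hne => ?_⟩
  · refine measurable_uncurry_of_continuous_of_measurable (fun μ => ?_) fun x => ?_
    · by_cases hμ : μ ∈ S
      · simp only [indicator_of_mem hμ]
        have : ContinuousOn (fun y => ψ y μ) (Icc 0 B) := fun y hy =>
          (htr μ hμ.1 hμ.2 y hy).continuousWithinAt
        exact this.comp_continuous hcc hcm
      · simp only [indicator_of_notMem hμ]
        exact continuous_const
    · have : S.indicator (ψ (c x)) =
          S.indicator fun μ => Real.exp (-(c x / μ)) * (I μ + G (c x) μ) := by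
        refine indicator_congr fun μ hμ => ?_
        rw [← hI0 μ hμ, ← transport_eq hμ.2 hg (htr μ hμ.1 hμ.2) (hcm x), ← mul_assoc,
          ← Real.exp_add]
        simp
      rw [this]
      have := hG (c x) (hcm x).1
      exact Measurable.indicator (by fun_prop) hS
  · by_cases hμ : μ ∈ S
    · simp only [indicator_of_mem hμ]
      exact hM _ (hcm x) _ hμ.1
    · simp only [indicator_of_notMem hμ]
      exact ⟨le_rfl, hM0⟩
  · simp only [indicator_of_mem (show μ ∈ S from ⟨hμ, hne⟩), hce x hx]

/-- Weighted energy estimate for the nonlinear Milne problem on the bounded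
interval [0,B]. -/
theorem stmt_6 (B γ Tb : ℝ) (hB : 0 < B) (hγ : 0 < γ) (hTb : Tb ∈ Set.Icc 0 γ)
    (ψb : ℝ → ℝ) (hψbmeas : Measurable ψb)
    (hψb : ∀ μ ∈ Set.Ioc (0:ℝ) 1, ψb μ ∈ Set.Icc 0 (γ ^ 4))
    (T T' T'' : ℝ → ℝ) (ψ ψ' : ℝ → ℝ → ℝ)
    (hT1 : ∀ x ∈ Set.Icc (0:ℝ) B, HasDerivWithinAt T (T' x) (Set.Icc 0 B) x)
    (hT2 : ∀ x ∈ Set.Icc (0:ℝ) B, HasDerivWithinAt T' (T'' x) (Set.Icc 0 B) x)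
    (hT2c : ContinuousOn T'' (Set.Icc 0 B))
    (hψreg : ∀ μ ∈ Set.Icc (-1:ℝ) 1, μ ≠ 0 →
      (∀ x ∈ Set.Icc (0:ℝ) B, HasDerivWithinAt (fun y => ψ y μ) (ψ' x μ) (Set.Icc 0 B) x) ∧
      ContinuousOn (fun x => ψ' x μ) (Set.Icc 0 B))
    (hTbd : ∀ x ∈ Set.Icc (0:ℝ) B, T x ∈ Set.Icc 0 γ)
    (hψbd : ∀ x ∈ Set.Icc (0:ℝ) B, ∀ μ ∈ Set.Icc (-1:ℝ) 1, ψ x μ ∈ Set.Icc 0 (γ ^ 4))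
    -- the system
    (hode : ∀ x ∈ Set.Icc (0:ℝ) B, T'' x + (∫ μ in (-1:ℝ)..1, (ψ x μ - T x ^ 4)) = 0)
    (htr : ∀ x ∈ Set.Icc (0:ℝ) B, ∀ μ ∈ Set.Icc (-1:ℝ) 1, μ ≠ 0 →
      μ * ψ' x μ + ψ x μ - T x ^ 4 = 0)
    -- boundary conditions
    (hT0 : T 0 = Tb) (hTB : T' B = 0)
    (hψ0 : ∀ μ ∈ Set.Ioc (0:ℝ) 1, ψ 0 μ = ψb μ)
    (hψB : ∀ μ ∈ Set.Ioc (0:ℝ) 1, ψ B μ = ψ B (-μ)) :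
    ∀ α ∈ Set.Ico (0:ℝ) 1,
      (∫ x in (0:ℝ)..B, Real.exp (2*α*x) * (4 * T x ^ 3 * T' x ^ 2))
        + (1 - α) * (∫ x in (0:ℝ)..B,
            (∫ μ in (-1:ℝ)..1, Real.exp (2*α*x) * (ψ x μ - T x ^ 4) ^ 2))
        + (1/2) * (∫ μ in (-1:ℝ)..0, |μ| * (ψ 0 μ - Tb ^ 4) ^ 2)
        ≤ (1/2) * (∫ μ in (0:ℝ)..1, μ * (ψb μ - Tb ^ 4) ^ 2) := by
  intro α hα
  let c : ℝ → ℝ := fun x => projIcc 0 B hB.le x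
  have hcm : ∀ x, c x ∈ Icc 0 B := fun x => (projIcc 0 B hB.le x).2
  have hcc : Continuous c := continuous_subtype_val.comp continuous_projIcc
  have hce : ∀ x ∈ Icc 0 B, c x = x := fun x hx => by simp [c, projIcc_of_mem hB.le hx]
  have h0 : (0 : ℝ) ∈ Icc 0 B := left_mem_Icc.2 hB.le
  have hBm : B ∈ Icc 0 B := right_mem_Icc.2 hB.le
  have hτc : Continuous fun x => T (c x) :=
    ContinuousOn.comp_continuous (fun x hx => (hT1 x hx).continuousWithinAt) hcc hcm
  have hσc : Continuous fun x => T' (c x) :=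
    ContinuousOn.comp_continuous (fun x hx => (hT2 x hx).continuousWithinAt) hcc hcm
  have htr' : ∀ μ ∈ Icc (-1 : ℝ) 1, μ ≠ 0 → ∀ x ∈ Icc 0 B,
      HasDerivWithinAt (fun y => ψ y μ) ((T (c x) ^ 4 - ψ x μ) / μ) (Icc 0 B) x :=
    fun μ hμ hne x hx => by
      refine ((hψreg μ hμ hne).1 x hx).congr_deriv ?_
      rw [eq_div_iff hne, hce x hx]
      linarith [htr x hx μ hμ hne]
  obtain ⟨v, hv, hvM, hvψ⟩ := exists_measurable_intensity hB.le (pow_nonneg hγ.le 4) hψbmeas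
    (hτc.pow 4) htr' hψbd hψ0 hψB
  have key := milne_energy_le hB.le hv hvM hτc hσc (σ' := T'')
    (fun x hx => by
      rw [hce x hx]
      exact (hT1 x hx).congr (fun y hy => by rw [hce y hy]) (by rw [hce x hx]))
    (fun x hx => (hT2 x hx).congr (fun y hy => by rw [hce y hy]) (by rw [hce x hx]))
    hT2c
    (fun x hx => by
      rw [← hode x hx, hce x hx]
      congr 1
      exact intervalIntegral_congr_off_zero (by norm_num) fun μ hμ hne => by
        rw [hvψ x hx μ hμ hne])
    (fun μ hμ hne x hx => by
      rw [hvψ x hx μ hμ hne]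
      exact (htr' μ hμ hne x hx).congr (fun y hy => hvψ y hy μ hμ hne) (hvψ x hx μ hμ hne))
    (by rw [hce B hBm, hTB])
    (fun μ hμ => by
      rw [hvψ B hBm μ ⟨by linarith [hμ.1], hμ.2⟩ hμ.1.ne',
        hvψ B hBm (-μ) ⟨by linarith [hμ.2], by linarith [hμ.1]⟩ (neg_ne_zero.2 hμ.1.ne'),
        hψB μ hμ])
    hα.1
  convert key using 2
  · congr 1
    · refine intervalIntegral.integral_congr fun x hx => ?_
      rw [uIcc_of_le hB.le] at hx
      simp only [hce x hx]
    · congr 1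
      refine intervalIntegral.integral_congr fun x hx => ?_
      rw [uIcc_of_le hB.le] at hx
      simp only [hce x hx]
      exact intervalIntegral_congr_off_zero (by norm_num) fun μ hμ hne => by
        rw [hvψ x hx μ hμ hne]
  · congr 1
    refine intervalIntegral_congr_off_zero (by norm_num) fun μ hμ hne => ?_
    rw [hvψ 0 h0 μ ⟨hμ.1, by linarith [hμ.2]⟩ hne, hce 0 h0, hT0]
  · refine intervalIntegral_congr_off_zero (by norm_num) fun μ hμ hne => ?_
    rw [hvψ 0 h0 μ ⟨by linarith [hμ.1], hμ.2⟩ hne, hce 0 h0, hT0,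
      hψ0 μ ⟨lt_of_le_of_ne hμ.1 hne.symm, hμ.2⟩]
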